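/- If, for some real ε, the function t ↦ t^{4+ε} · Q(t) is completely monotonic on (0, ∞), then for every t > 0 one has ε < −4 − t Q'(t)/Q(t); consequently ε ≤ 1. -/

import Mathlib

open Real Set Filter Topology

/-- The trigamma function `ψ'(t) = ∑_{n=0}^∞ 1/(t+n)^2`. -/
noncomputable def trigamma (t : ℝ) : ℝ := ∑' n : ℕ, 1 / (t + n) ^ 2

/-- `Q(t) = ψ'(t) − 1/t − 1/(2t²) − 1/(6t³) + 1/(30t⁵)`. -/
noncomputable def Q (t : ℝ) : ℝ :=
  trigamma t - 1 / t - 1 / (2 * t ^ 2) - 1 / (6 * t ^ 3) + 1 / (30 * t ^ 5)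

/-- A function is completely monotonic on `(0, ∞)` if it is infinitely differentiable there
and `(−1)ⁿ f⁽ⁿ⁾(t) ≥ 0` for all `n ≥ 0` and `t > 0`. -/
def CompletelyMonotonicOn (f : ℝ → ℝ) : Prop :=
  ContDiffOn ℝ (⊤ : ℕ∞) f (Ioi 0) ∧
    ∀ n : ℕ, ∀ t : ℝ, 0 < t → 0 ≤ (-1 : ℝ) ^ n * iteratedDeriv n f t

theorem summable_one_div_add_nat_sq {t : ℝ} (ht : 0 < t) :
    Summable fun n : ℕ => 1 / (t + n) ^ 2 := by
  refine ((Real.summable_one_div_nat_add_rpow t 2).2 one_lt_two).congr fun n => ?_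
  rw [abs_of_pos (by positivity), Real.rpow_two, add_comm]

/-- The part of the asymptotic expansion of the trigamma function that `Q` subtracts. -/
noncomputable def trigammaApprox (t : ℝ) : ℝ :=
  1 / t + 1 / (2 * t ^ 2) + 1 / (6 * t ^ 3) - 1 / (30 * t ^ 5)

theorem Q_eq_trigamma_sub (t : ℝ) : Q t = trigamma t - trigammaApprox t := by
  unfold Q trigammaApprox
  ring

theorem tendsto_trigammaApprox_atTop : Tendsto trigammaApprox atTop (𝓝 0) := by
  have h : Tendsto (fun t : ℝ => t⁻¹) atTop (𝓝 0) := tendsto_inv_atTop_zero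
  have := (((h.add ((h.pow 2).const_mul (1 / 2))).add ((h.pow 3).const_mul (1 / 6))).sub
    ((h.pow 5).const_mul (1 / 30)))
  refine (this.congr fun t => ?_).trans (by norm_num)
  simp only [trigammaApprox, one_div, mul_inv, inv_pow]

/-- The difference `Q t - Q (t + 1)`, in closed form. -/
noncomputable def QStep (t : ℝ) : ℝ := (5 * t ^ 2 + 5 * t + 1) / (30 * (t ^ 5 * (t + 1) ^ 5))

theorem QStep_pos {t : ℝ} (ht : 0 < t) : 0 < QStep t := by
  unfold QStep
  positivity

theorem one_div_sq_eq {t : ℝ} (ht : 0 < t) :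
    1 / t ^ 2 = trigammaApprox t - trigammaApprox (t + 1) + QStep t := by
  have : t + 1 ≠ 0 := by positivity
  unfold trigammaApprox QStep
  field_simp
  ring

theorem QStep_le {t : ℝ} (ht : 0 < t) :
    QStep t ≤ 1 / (42 * t ^ 7) - 1 / (42 * (t + 1) ^ 7) := by
  have h : 1 / (42 * t ^ 7) - 1 / (42 * (t + 1) ^ 7) - QStep t =
      (5 * ((t + 1) ^ 7 - t ^ 7) - 7 * (t ^ 2 * (t + 1) ^ 2 * (5 * t ^ 2 + 5 * t + 1))) /
        (210 * (t ^ 7 * (t + 1) ^ 7)) := by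
    have : t + 1 ≠ 0 := by positivity
    unfold QStep
    field_simp
    ring
  have hpoly : 5 * ((t + 1) ^ 7 - t ^ 7) - 7 * (t ^ 2 * (t + 1) ^ 2 * (5 * t ^ 2 + 5 * t + 1)) =
      63 * t ^ 4 + 126 * t ^ 3 + 98 * t ^ 2 + 35 * t + 5 := by
    ring
  have : 0 ≤ 1 / (42 * t ^ 7) - 1 / (42 * (t + 1) ^ 7) - QStep t := by
    rw [h, hpoly]
    positivity
  linarith

theorem tendsto_sum_QStep {t : ℝ} (ht : 0 < t) :
    Tendsto (fun N : ℕ => ∑ n ∈ Finset.range N, QStep (t + n)) atTop (𝓝 (Q t)) := by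
  have hsum : ∀ N : ℕ, ∑ n ∈ Finset.range N, QStep (t + n) =
      ∑ n ∈ Finset.range N, 1 / (t + n) ^ 2 - (trigammaApprox t - trigammaApprox (t + N)) := by
    intro N
    induction N with
    | zero => simp
    | succ N ih =>
      rw [Finset.sum_range_succ, Finset.sum_range_succ, ih,
        one_div_sq_eq (t := t + N) (by positivity)]
      rw [Nat.cast_succ, ← add_assoc t]
      ring
  have hzero : Tendsto (fun N : ℕ => trigammaApprox (t + N)) atTop (𝓝 0) :=
    tendsto_trigammaApprox_atTop.comp (tendsto_atTop_add_const_left _ t tendsto_natCast_atTop_atTop)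
  have := (summable_one_div_add_nat_sq ht).hasSum.tendsto_sum_nat.sub
    (hzero.const_sub (trigammaApprox t))
  rw [sub_zero] at this
  rw [Q_eq_trigamma_sub]
  exact this.congr fun N => (hsum N).symm

theorem QStep_le_Q {t : ℝ} (ht : 0 < t) : QStep t ≤ Q t := by
  refine ge_of_tendsto (tendsto_sum_QStep ht) ?_
  filter_upwards [eventually_ge_atTop 1] with N hN
  simpa using Finset.single_le_sum (f := fun n : ℕ => QStep (t + n))
    (fun n _ => (QStep_pos (by positivity)).le) (Finset.mem_range.2 hN)

theorem Q_pos {t : ℝ} (ht : 0 < t) : 0 < Q t := (QStep_pos ht).trans_le (QStep_le_Q ht)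

theorem Q_le_one_div {t : ℝ} (ht : 0 < t) : Q t ≤ 1 / (42 * t ^ 7) := by
  refine le_of_tendsto' (tendsto_sum_QStep ht) fun N => ?_
  have h : ∑ n ∈ Finset.range N, QStep (t + n) ≤
      1 / (42 * t ^ 7) - 1 / (42 * (t + N) ^ 7) := by
    induction N with
    | zero => simp
    | succ N ih =>
      have := QStep_le (t := t + N) (by positivity)
      rw [Finset.sum_range_succ]
      push_cast
      rw [← add_assoc]
      linarith
  have : 0 ≤ 1 / (42 * (t + N) ^ 7) := by positivity
  linarith

theorem Q_eq_QStep_add {t : ℝ} (ht : 0 < t) : Q t = QStep t + Q (t + 1) := by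
  have h := (tendsto_sum_QStep (t := t + 1) (by positivity)).const_add (QStep t)
  refine tendsto_nhds_unique ((tendsto_add_atTop_iff_nat 1).2 (tendsto_sum_QStep ht))
    (h.congr fun N => ?_)
  rw [Finset.sum_range_succ', add_comm]
  congr 1
  · exact Finset.sum_congr rfl fun n _ => by push_cast; ring_nf
  · simp

theorem pow_five_mul_Q_le_one {t : ℝ} (ht : 0 < t) (ht1 : t ≤ 1) : t ^ 5 * Q t ≤ 1 := by
  have hstep : t ^ 5 * QStep t = (5 * t ^ 2 + 5 * t + 1) / (30 * (t + 1) ^ 5) := by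
    unfold QStep
    field_simp
  have hstep' : t ^ 5 * QStep t ≤ 1 / 2 := by
    rw [hstep, div_le_div_iff₀ (by positivity) (by positivity)]
    have : 1 ≤ (t + 1) ^ 5 := one_le_pow₀ (by linarith)
    nlinarith
  have hQ : Q (t + 1) ≤ 1 / 2 := by
    refine (Q_le_one_div (by positivity)).trans (one_div_le_one_div_of_le (by norm_num) ?_)
    have : 1 ≤ (t + 1) ^ 7 := one_le_pow₀ (by linarith)
    linarith
  have hpow : t ^ 5 ≤ 1 := pow_le_one₀ ht.le ht1
  have hmul : t ^ 5 * Q (t + 1) ≤ 1 * (1 / 2) :=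
    mul_le_mul hpow hQ (Q_pos (by positivity)).le zero_le_one
  rw [Q_eq_QStep_add ht, mul_add]
  linarith

theorem le_one_of_antitoneOn_rpow_mul_Q {ε : ℝ}
    (hf : AntitoneOn (fun t : ℝ => t ^ ((4 : ℝ) + ε) * Q t) (Ioi 0)) : ε ≤ 1 := by
  by_contra! hε
  have hlim : Tendsto (fun t : ℝ => t ^ (ε - 1)) (𝓝[>] 0) (𝓝 0) := by
    have h := (Real.continuousAt_rpow_const 0 (ε - 1) (Or.inr (by linarith))).tendsto
    rw [Real.zero_rpow (by linarith)] at h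
    exact h.mono_left nhdsWithin_le_nhds
  have hle : (1 : ℝ) ^ ((4 : ℝ) + ε) * Q 1 ≤ 0 := by
    refine ge_of_tendsto hlim ?_
    filter_upwards [Ioc_mem_nhdsGT (zero_lt_one (α := ℝ))] with t ⟨ht, ht1⟩
    refine (hf (mem_Ioi.2 ht) (mem_Ioi.2 one_pos) ht1).trans ?_
    have hsplit : t ^ ((4 : ℝ) + ε) = t ^ (ε - 1) * t ^ 5 := by
      rw [← Real.rpow_natCast, ← Real.rpow_add ht]
      norm_num
      ring_nf
    simp only [hsplit, mul_assoc]
    exact mul_le_of_le_one_right (Real.rpow_nonneg ht.le _) (pow_five_mul_Q_le_one ht ht1)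
  rw [Real.one_rpow, one_mul] at hle
  exact hle.not_gt (Q_pos one_pos)

theorem tendsto_rpow_mul_Q_atTop {ε : ℝ} (hε : ε ≤ 1) :
    Tendsto (fun t : ℝ => t ^ ((4 : ℝ) + ε) * Q t) atTop (𝓝 0) := by
  refine squeeze_zero' ?_ ?_ tendsto_inv_atTop_zero
  · filter_upwards [eventually_gt_atTop 0] with t ht
    exact mul_nonneg (Real.rpow_nonneg ht.le _) (Q_pos ht).le
  · filter_upwards [eventually_ge_atTop 1] with t ht
    have h0 : 0 < t := by linarith
    have hpow : t ^ ((4 : ℝ) + ε) ≤ t ^ 5 := by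
      rw [← Real.rpow_natCast]
      exact Real.rpow_le_rpow_of_exponent_le ht (by push_cast; linarith)
    calc t ^ ((4 : ℝ) + ε) * Q t ≤ t ^ 5 * (1 / (42 * t ^ 7)) :=
          mul_le_mul hpow (Q_le_one_div h0) (Q_pos h0).le (by positivity)
      _ = 1 / (42 * t ^ 2) := by field_simp
      _ ≤ 1 / t := one_div_le_one_div_of_le h0 (by nlinarith)
      _ = t⁻¹ := one_div t

namespace CompletelyMonotonicOn

variable {f : ℝ → ℝ}

theorem differentiableAt (hf : CompletelyMonotonicOn f) {t : ℝ} (ht : 0 < t) :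
    DifferentiableAt ℝ f t :=
  (hf.1.contDiffAt (Ioi_mem_nhds ht)).differentiableAt (by simp)

theorem deriv_nonpos (hf : CompletelyMonotonicOn f) {t : ℝ} (ht : 0 < t) : deriv f t ≤ 0 := by
  have h := hf.2 1 t ht
  rw [iteratedDeriv_one] at h
  linarith

theorem antitoneOn (hf : CompletelyMonotonicOn f) : AntitoneOn f (Ioi 0) := by
  refine antitoneOn_of_deriv_nonpos (convex_Ioi 0) hf.1.continuousOn
    (fun t ht => ?_) fun t ht => ?_
  all_goals rw [interior_Ioi] at ht
  · exact (hf.differentiableAt ht).differentiableWithinAt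
  · exact hf.deriv_nonpos ht

theorem monotoneOn_deriv (hf : CompletelyMonotonicOn f) : MonotoneOn (deriv f) (Ioi 0) := by
  have hd : DifferentiableOn ℝ (deriv f) (Ioi 0) :=
    (hf.1.deriv_of_isOpen (m := 1) isOpen_Ioi (WithTop.coe_le_coe.2 le_top)).differentiableOn
      (by simp)
  refine monotoneOn_of_deriv_nonneg (convex_Ioi 0) hd.continuousOn
    (hd.mono interior_subset) fun t ht => ?_
  rw [interior_Ioi] at ht
  have h := hf.2 2 t ht
  rw [iteratedDeriv_succ, iteratedDeriv_one] at h
  simpa using h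

theorem eq_of_deriv_eq_zero (hf : CompletelyMonotonicOn f) {t : ℝ} (ht : 0 < t)
    (h : deriv f t = 0) {s : ℝ} (hs : t ≤ s) : f s = f t := by
  refine le_antisymm (hf.antitoneOn ht (ht.trans_le hs) hs) ?_
  have hpos : ∀ u ∈ Ici t, 0 < u := fun u hu => ht.trans_le hu
  refine monotoneOn_of_deriv_nonneg (convex_Ici t) (hf.1.continuousOn.mono hpos)
    (fun u hu => ?_) (fun u hu => ?_) self_mem_Ici hs hs
  · exact (hf.differentiableAt (hpos u (interior_subset hu))).differentiableWithinAt
  · have hu := interior_subset hu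
    exact h ▸ hf.monotoneOn_deriv ht (hpos u hu) hu

/-- A completely monotonic function with a critical point is constant to the right of it; hence one
that tends to `0` and is positive has negative derivative. -/
theorem deriv_neg_of_tendsto_zero (hf : CompletelyMonotonicOn f) (hlim : Tendsto f atTop (𝓝 0))
    {t : ℝ} (ht : 0 < t) (hft : 0 < f t) : deriv f t < 0 := by
  refine (hf.deriv_nonpos ht).lt_of_ne fun h => hft.ne' ?_
  refine tendsto_nhds_unique (tendsto_const_nhds.congr' ?_) hlim
  filter_upwards [eventually_ge_atTop t] with s hs
  exact (hf.eq_of_deriv_eq_zero ht h hs).symm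

end CompletelyMonotonicOn

theorem differentiableAt_of_rpow_mul {a : ℝ} {g : ℝ → ℝ} {t : ℝ} (ht : 0 < t)
    (h : DifferentiableAt ℝ (fun t : ℝ => t ^ a * g t) t) : DifferentiableAt ℝ g t := by
  have hpow : DifferentiableAt ℝ (fun t : ℝ => t ^ (-a)) t :=
    Real.differentiableAt_rpow_const_of_ne (-a) ht.ne'
  refine (hpow.mul h).congr_of_eventuallyEq ?_
  filter_upwards [Ioi_mem_nhds ht] with s hs
  simp only [Pi.mul_apply]
  rw [← mul_assoc, ← Real.rpow_add hs, neg_add_cancel, Real.rpow_zero, one_mul]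

/-- If for some real `ε` the function `t ↦ t^{4+ε} · Q(t)` is completely monotonic on
`(0, ∞)`, then `ε < −4 − t Q'(t)/Q(t)` for every `t > 0`; consequently `ε ≤ 1`. -/
theorem eps_lt_of_completelyMonotonic (ε : ℝ)
    (hcm : CompletelyMonotonicOn (fun t : ℝ => t ^ ((4 : ℝ) + ε) * Q t)) :
    (∀ t : ℝ, 0 < t → ε < -4 - t * (deriv Q t / Q t)) ∧ ε ≤ 1 := by
  have hε : ε ≤ 1 := le_one_of_antitoneOn_rpow_mul_Q hcm.antitoneOn
  refine ⟨fun t ht => ?_, hε⟩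
  have hQ := Q_pos ht
  have hneg := hcm.deriv_neg_of_tendsto_zero (tendsto_rpow_mul_Q_atTop hε) ht
    (mul_pos (Real.rpow_pos_of_pos ht _) hQ)
  have hderiv := ((Real.hasDerivAt_rpow_const (p := (4 : ℝ) + ε) (Or.inl ht.ne')).fun_mul
    (differentiableAt_of_rpow_mul ht (hcm.differentiableAt ht)).hasDerivAt).deriv
  have hfactor : t ^ ((4 : ℝ) + ε) = t ^ ((4 : ℝ) + ε - 1) * t := by
    rw [← Real.rpow_add_one ht.ne', sub_add_cancel]
  rw [hderiv, hfactor] at hneg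
  have hpow : 0 < t ^ ((4 : ℝ) + ε - 1) := Real.rpow_pos_of_pos ht _
  have hlog : (4 + ε) * Q t + t * deriv Q t < 0 := by
    refine neg_of_mul_neg_right (a := t ^ ((4 : ℝ) + ε - 1)) ?_ hpow.le
    linarith
  have hdiv : t * (deriv Q t / Q t) < -(4 + ε) := by
    rw [← mul_div_assoc, div_lt_iff₀ hQ]
    linarith
  linarith
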